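/- Let $R = \mathbb{C}[x,y,z]$ and let $I \subset R$ be an ideal generated by monomials each of the form $x^iz^j$ or $y^iz^j$ (i.e., no generator is divisible by both $x$ and $y$), and suppose $\dim_{\mathbb{C}} R/I = d < \infty$. Then $\dim_{\mathbb{C}} \operatorname{Hom}_R(I, R/I) = 3d$. -/

import Mathlib

open MvPolynomial

section Combinatorics

/-- A family `c` of coefficients, indexed by pairs of monomials and compatible with multiplication
by monomials, vanishes as soon as the coefficients listed in `hU`, `hV`, `hW₁`, `hW₂` do. -/
theorem eq_zero_of_rectangular_layers {a b : ℕ → ℕ} (ha : Antitone a) (hb : Antitone b)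
    {h : ℕ} (hh : ∀ l, h ≤ l → a l = 0)
    (c : ℕ → ℕ → ℕ → ℕ → ℕ → ℕ → ℂ)
    (hshift : ∀ i j k i' j' k' p q r, (a k ≤ i ∨ b k ≤ j) →
      i' + p < a (k' + r) → j' + q < b (k' + r) →
      c (i + p) (j + q) (k + r) (i' + p) (j' + q) (k' + r) = c i j k i' j' k')
    (hzero : ∀ i j k i' j' k' p q r, (a k ≤ i ∨ b k ≤ j) → i' < a k' → j' < b k' →
      (i' < p ∨ j' < q ∨ k' < r) → c (i + p) (j + q) (k + r) i' j' k' = 0)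
    (hU : ∀ i j k l, k ≤ l → i < a l → j < b l → (a (l + 1) ≤ i ∨ b (l + 1) ≤ j) →
      c (a k) 0 k i j l = 0)
    (hV : ∀ i j k l, k ≤ l → i < a l → j < b l → (a (l + 1) ≤ i ∨ b (l + 1) ≤ j) →
      c 0 (b k) k i j l = 0)
    (hW₁ : ∀ i j k l, l ≤ k → i < a k → j < b k → a (k + 1) ≤ i →
      c (a (k + 1)) 0 (k + 1) (a l - 1 - i + a (k + 1)) (b l - 1 - j) l = 0)
    (hW₂ : ∀ i j k l, l ≤ k → i < a k → j < b k → i < a (k + 1) → b (k + 1) ≤ j →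
      c 0 (b (k + 1)) (k + 1) (a l - 1 - i) (b l - 1 - j + b (k + 1)) l = 0)
    (i j k i' j' k' : ℕ) (hm : a k ≤ i ∨ b k ≤ j) (hi : i' < a k') (hj : j' < b k') :
    c i j k i' j' k' = 0 := by
  have rect : ∀ i j k i' j' k' i₁ j₁, (a k ≤ i ∨ b k ≤ j) → i ≤ i₁ → j ≤ j₁ →
      i' < a k' → j' < b k' →
      c i₁ j₁ k i' j' k' = if i₁ - i ≤ i' ∧ j₁ - j ≤ j' then
        c i j k (i' - (i₁ - i)) (j' - (j₁ - j)) k' else 0 := by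
    intro i j k i' j' k' i₁ j₁ hm h1 h2 h4 h5
    obtain ⟨p, rfl⟩ := Nat.exists_eq_add_of_le h1
    obtain ⟨q, rfl⟩ := Nat.exists_eq_add_of_le h2
    simp only [Nat.add_sub_cancel_left]
    split_ifs with hc
    · obtain ⟨hp, hq⟩ := hc
      obtain ⟨i', rfl⟩ := Nat.exists_eq_add_of_le' hp
      obtain ⟨j', rfl⟩ := Nat.exists_eq_add_of_le' hq
      simp only [Nat.add_sub_cancel]
      exact hshift i j k i' j' k' p q 0 hm h4 h5
    · exact hzero i j k i' j' k' p q 0 hm h4 h5 (by omega)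
  have nonneg : ∀ s l k i j, h ≤ l + s → k ≤ l → i < a l → j < b l →
      c (a k) 0 k i j l = 0 ∧ c 0 (b k) k i j l = 0 := by
    intro s
    induction s with
    | zero => intro l k i j hl _ hi; rw [hh l (by omega)] at hi; omega
    | succ s ih =>
      intro l k i j hl hk hi hj
      by_cases htop : a (l + 1) ≤ i ∨ b (l + 1) ≤ j
      · exact ⟨hU i j k l hk hi hj htop, hV i j k l hk hi hj htop⟩
      push Not at htop
      have hak := ha k.le_succ
      have hbk := hb k.le_succ
      simp only [Nat.succ_eq_add_one] at hak hbk
      constructor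
      · rw [← hshift (a k) 0 k i j l 0 0 1 (by simp) htop.1 htop.2]
        simp only [add_zero]
        rw [rect (a (k + 1)) 0 (k + 1) _ _ _ _ _ (by simp) (by omega) (by omega)
          htop.1 htop.2]
        split_ifs
        · exact (ih (l + 1) (k + 1) _ _ (by omega) (by omega) (by omega) (by omega)).1
        · rfl
      · rw [← hshift 0 (b k) k i j l 0 0 1 (by simp) htop.1 htop.2]
        simp only [add_zero]
        rw [rect 0 (b (k + 1)) (k + 1) _ _ _ _ _ (by simp) (by omega) (by omega)
          htop.1 htop.2]
        split_ifs
        · exact (ih (l + 1) (k + 1) _ _ (by omega) (by omega) (by omega) (by omega)).2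
        · rfl
  have step : ∀ l k, l ≤ k →
      (∀ i j, i < a l → j < b l → c (a k) 0 (k + 1) i j l = 0 ∧ c 0 (b k) (k + 1) i j l = 0) →
      ∀ i j, i < a l → j < b l →
        c (a (k + 1)) 0 (k + 1) i j l = 0 ∧ c 0 (b (k + 1)) (k + 1) i j l = 0 := by
    intro l k hlk hz
    have hak := ha k.le_succ
    have hbk := hb k.le_succ
    have hal := ha hlk
    have hbl := hb hlk
    simp only [Nat.succ_eq_add_one] at hak hbk
    have hu : ∀ i j, j < b l → i + (a k - a (k + 1)) < a l →
        c (a (k + 1)) 0 (k + 1) i j l = 0 := by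
      intro i j hj hi
      rw [← hshift (a (k + 1)) 0 (k + 1) i j l (a k - a (k + 1)) 0 0 (by simp) hi hj,
        Nat.add_sub_cancel' hak]
      exact (hz _ _ hi hj).1
    have hv : ∀ i j, i < a l → j + (b k - b (k + 1)) < b l →
        c 0 (b (k + 1)) (k + 1) i j l = 0 := by
      intro i j hi hj
      rw [← hshift 0 (b (k + 1)) (k + 1) i j l 0 (b k - b (k + 1)) 0 (by simp) hi hj,
        Nat.add_sub_cancel' hbk]
      exact (hz _ _ hi hj).2
    have hu' : ∀ i j, i < a l → j < b l → c (a (k + 1)) 0 (k + 1) i j l = 0 := by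
      intro i j hi hj
      by_cases h1 : i + (a k - a (k + 1)) < a l
      · exact hu i j hj h1
      by_cases h2 : j + b k < b l
      · rw [← hshift (a (k + 1)) 0 (k + 1) i j l 0 (b (k + 1)) 0 (by simp) hi
          (by simp only [add_zero]; omega)]
        simp only [add_zero]
        rw [rect 0 (b (k + 1)) (k + 1) _ _ _ _ _ (by simp) (by omega) (by omega)
          hi (by omega)]
        split_ifs
        · exact hv _ _ (by omega) (by omega)
        · rfl
      · have := hW₁ (a l - 1 - (i - a (k + 1))) (b l - 1 - j) k l hlk (by omega) (by omega)
          (by omega)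
        rwa [show a l - 1 - (a l - 1 - (i - a (k + 1))) + a (k + 1) = i by omega,
          show b l - 1 - (b l - 1 - j) = j by omega] at this
    refine fun i j hi hj => ⟨hu' i j hi hj, ?_⟩
    by_cases h1 : j + (b k - b (k + 1)) < b l
    · exact hv i j hi h1
    by_cases h2 : i + a (k + 1) < a l
    · rw [← hshift 0 (b (k + 1)) (k + 1) i j l (a (k + 1)) 0 0 (by simp) h2 hj]
      simp only [add_zero]
      rw [rect (a (k + 1)) 0 (k + 1) _ _ _ _ _ (by simp) (by omega) (by omega) h2 hj]
      split_ifs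
      · exact hu' _ _ (by omega) (by omega)
      · rfl
    · have := hW₂ (a l - 1 - i) (b l - 1 - (j - b (k + 1))) k l hlk (by omega) (by omega)
        (by omega) (by omega)
      rwa [show b l - 1 - (b l - 1 - (j - b (k + 1))) + b (k + 1) = j by omega,
        show a l - 1 - (a l - 1 - i) = i by omega] at this
  have neg : ∀ l k, l ≤ k → ∀ i j, i < a l → j < b l →
      c (a (k + 1)) 0 (k + 1) i j l = 0 ∧ c 0 (b (k + 1)) (k + 1) i j l = 0 := by
    intro l
    induction l with
    | zero =>
      refine fun k hk => step 0 k hk fun i j hi hj => ⟨?_, ?_⟩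
      · exact hzero (a k) 0 k i j 0 0 0 1 (by simp) hi hj (by simp)
      · exact hzero 0 (b k) k i j 0 0 0 1 (by simp) hi hj (by simp)
    | succ l ih =>
      intro k hk
      obtain ⟨k, rfl⟩ : ∃ k₀, k = k₀ + 1 := ⟨k - 1, by omega⟩
      refine step (l + 1) (k + 1) hk fun i j hi hj => ?_
      have := ih k (by omega) i j (hi.trans_le (ha l.le_succ)) (hj.trans_le (hb l.le_succ))
      exact ⟨(hshift (a (k + 1)) 0 (k + 1) i j l 0 0 1 (by simp) hi hj).trans this.1,
        (hshift 0 (b (k + 1)) (k + 1) i j l 0 0 1 (by simp) hi hj).trans this.2⟩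
  have gens : ∀ k i j l, i < a l → j < b l →
      c (a k) 0 k i j l = 0 ∧ c 0 (b k) k i j l = 0 := by
    intro k i j l hi hj
    rcases le_or_gt k l with hk | hk
    · exact nonneg h l k i j (by omega) hk hi hj
    · obtain ⟨k, rfl⟩ : ∃ k₀, k = k₀ + 1 := ⟨k - 1, by omega⟩
      exact neg l k (by omega) i j hi hj
  rcases hm with hm | hm
  · rw [rect (a k) 0 k _ _ _ _ _ (by simp) hm (by omega) hi hj]
    split_ifs
    · exact (gens _ _ _ _ (by omega) (by omega)).1
    · rfl
  · rw [rect 0 (b k) k _ _ _ _ _ (by simp) (by omega) hm hi hj]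
    split_ifs
    · exact (gens _ _ _ _ (by omega) (by omega)).2
    · rfl

end Combinatorics

section Algebra

variable {σ : Type*}

/-- The predicate that `I` is spanned by the monomials it contains. -/
def IsMonomialIdeal (I : Ideal (MvPolynomial σ ℂ)) : Prop :=
  ∀ f ∈ I, ∀ m ∈ f.support, monomial m (1 : ℂ) ∈ I

theorem isMonomialIdeal_span (S : Set (σ →₀ ℕ)) :
    IsMonomialIdeal (Ideal.span ((fun s => (monomial s (1 : ℂ) : MvPolynomial σ ℂ)) '' S)) := by
  intro f hf m hm
  rw [mem_ideal_span_monomial_image] at hf ⊢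
  intro n hn
  rw [Finset.mem_singleton.1 (support_monomial_subset hn)]
  exact hf m hm

theorem monomial_one_mem_of_le {I : Ideal (MvPolynomial σ ℂ)} {m n : σ →₀ ℕ} (hmn : m ≤ n)
    (hm : monomial m (1 : ℂ) ∈ I) : monomial n (1 : ℂ) ∈ I := by
  have := I.mul_mem_left (monomial (n - m) 1) hm
  rwa [monomial_mul, one_mul, tsub_add_cancel_of_le hmn] at this

theorem monomial_smul_mk (I : Ideal (MvPolynomial σ ℂ)) (m e : σ →₀ ℕ) :
    monomial e (1 : ℂ) • Ideal.Quotient.mk I (monomial m 1) =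
      Ideal.Quotient.mk I (monomial (m + e) 1) := by
  rw [add_comm, ← one_mul (1 : ℂ), ← monomial_mul, one_mul]
  rfl

open Classical in
/-- The linear functional on `R ⧸ I` induced by the `n`-th coefficient; zero if that coefficient
does not vanish on `I`. -/
noncomputable def quotCoeff (I : Ideal (MvPolynomial σ ℂ)) (n : σ →₀ ℕ) :
    (MvPolynomial σ ℂ ⧸ I) →ₗ[ℂ] ℂ :=
  if h : I.restrictScalars ℂ ≤ LinearMap.ker (lcoeff ℂ n) then
    (Submodule.liftQ (I.restrictScalars ℂ) (lcoeff ℂ n) h) ∘ₗ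
      (Submodule.Quotient.restrictScalarsEquiv ℂ I).symm.toLinearMap
  else 0

variable {I : Ideal (MvPolynomial σ ℂ)} (hI : IsMonomialIdeal I)
include hI

theorem quotCoeff_mk {n : σ →₀ ℕ} (hn : monomial n (1 : ℂ) ∉ I) (f : MvPolynomial σ ℂ) :
    quotCoeff I n (Ideal.Quotient.mk I f) = coeff n f := by
  have h : I.restrictScalars ℂ ≤ LinearMap.ker (lcoeff ℂ n) := by
    intro f hf
    by_contra hc
    exact hn (hI f hf n (mem_support_iff.2 hc))
  rw [quotCoeff, dif_pos h]
  rfl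

theorem quotCoeff_smul_add {n e : σ →₀ ℕ} (hn : monomial (n + e) (1 : ℂ) ∉ I)
    (q : MvPolynomial σ ℂ ⧸ I) :
    quotCoeff I (n + e) (monomial e (1 : ℂ) • q) = quotCoeff I n q := by
  obtain ⟨f, rfl⟩ := Ideal.Quotient.mk_surjective q
  have hn' : monomial n (1 : ℂ) ∉ I := fun h => hn (monomial_one_mem_of_le (by simp) h)
  rw [← Ideal.Quotient.mk_eq_mk, ← Submodule.Quotient.mk_smul, Ideal.Quotient.mk_eq_mk,
    Ideal.Quotient.mk_eq_mk, quotCoeff_mk hI hn, quotCoeff_mk hI hn', smul_eq_mul, add_comm,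
    coeff_monomial_mul, one_mul]

theorem quotCoeff_smul_of_not_le {n e : σ →₀ ℕ} (hn : monomial n (1 : ℂ) ∉ I) (hne : ¬ e ≤ n)
    (q : MvPolynomial σ ℂ ⧸ I) : quotCoeff I n (monomial e (1 : ℂ) • q) = 0 := by
  obtain ⟨f, rfl⟩ := Ideal.Quotient.mk_surjective q
  rw [← Ideal.Quotient.mk_eq_mk, ← Submodule.Quotient.mk_smul, Ideal.Quotient.mk_eq_mk,
    quotCoeff_mk hI hn, smul_eq_mul, coeff_monomial_mul', if_neg hne]

theorem quotCoeff_ext {q : MvPolynomial σ ℂ ⧸ I}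
    (h : ∀ n, monomial n (1 : ℂ) ∉ I → quotCoeff I n q = 0) : q = 0 := by
  obtain ⟨f, rfl⟩ := Ideal.Quotient.mk_surjective q
  rw [Ideal.Quotient.eq_zero_iff_mem, f.as_sum]
  refine I.sum_mem fun n hn => ?_
  by_cases hnI : monomial n (1 : ℂ) ∈ I
  · simpa [C_mul_monomial] using I.mul_mem_left (C (coeff n f)) hnI
  · have := h n hnI
    rw [quotCoeff_mk hI hnI] at this
    simp [this]

/-- The monomials outside a monomial ideal form a basis of the quotient. -/
noncomputable def standardMonomialBasis :
    Module.Basis {n : σ →₀ ℕ // monomial n (1 : ℂ) ∉ I} ℂ (MvPolynomial σ ℂ ⧸ I) :=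
  Module.Basis.mk (v := fun n => Ideal.Quotient.mk I (monomial n.1 (1 : ℂ)))
    (by
      classical
      rw [linearIndependent_iff']
      intro s g hg n hn
      have := congrArg (quotCoeff I n.1) hg
      rw [map_sum, map_zero] at this
      simp only [map_smul, quotCoeff_mk hI n.2, coeff_monomial, Subtype.coe_inj] at this
      simpa [hn] using this)
    (by
      rintro q -
      obtain ⟨f, rfl⟩ := Ideal.Quotient.mk_surjective q
      rw [f.as_sum, map_sum]
      refine Submodule.sum_mem _ fun n _ => ?_
      by_cases hn : monomial n (1 : ℂ) ∈ I
      · rw [Ideal.Quotient.eq_zero_iff_mem.2]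
        · exact zero_mem _
        · simpa [C_mul_monomial] using I.mul_mem_left (C (coeff n f)) hn
      · have : Ideal.Quotient.mk I (monomial n (coeff n f)) =
            coeff n f • Ideal.Quotient.mk I (monomial n (1 : ℂ)) := by
          rw [← Ideal.Quotient.mkₐ_eq_mk ℂ, ← map_smul, smul_monomial, smul_eq_mul, mul_one]
        rw [this]
        exact Submodule.smul_mem _ _ (Submodule.subset_span ⟨⟨n, hn⟩, rfl⟩))

omit hI in
/-- The functional sending `φ : I → R ⧸ I` to the coefficient of the monomial `n` in the image
of the monomial `m`; zero if `m` is not in `I`. -/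
noncomputable def homCoeff (I : Ideal (MvPolynomial σ ℂ)) (m n : σ →₀ ℕ) :
    (I →ₗ[MvPolynomial σ ℂ] (MvPolynomial σ ℂ ⧸ I)) →ₗ[ℂ] ℂ :=
  open Classical in
  if h : monomial m (1 : ℂ) ∈ I then
    { toFun := fun φ => quotCoeff I n (φ ⟨_, h⟩)
      map_add' := fun φ ψ => by simp
      map_smul' := fun c φ => by simp }
  else 0

omit hI in
theorem homCoeff_apply {m : σ →₀ ℕ} (n : σ →₀ ℕ) (hm : monomial m (1 : ℂ) ∈ I)
    (φ : I →ₗ[MvPolynomial σ ℂ] (MvPolynomial σ ℂ ⧸ I)) :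
    homCoeff I m n φ = quotCoeff I n (φ ⟨_, hm⟩) := by
  rw [homCoeff, dif_pos hm]
  rfl

omit hI in
theorem map_monomial_add {M : Type*} [AddCommGroup M] [Module (MvPolynomial σ ℂ) M]
    {m : σ →₀ ℕ} (e : σ →₀ ℕ) (hm : monomial m (1 : ℂ) ∈ I)
    (hme : monomial (m + e) (1 : ℂ) ∈ I) (φ : I →ₗ[MvPolynomial σ ℂ] M) :
    φ ⟨_, hme⟩ = monomial e (1 : ℂ) • φ ⟨_, hm⟩ := by
  rw [← map_smul]
  congr 1
  ext1
  simp [monomial_mul, add_comm]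

theorem homCoeff_add_add {m n e : σ →₀ ℕ} (hm : monomial m (1 : ℂ) ∈ I)
    (hn : monomial (n + e) (1 : ℂ) ∉ I) (φ : I →ₗ[MvPolynomial σ ℂ] (MvPolynomial σ ℂ ⧸ I)) :
    homCoeff I (m + e) (n + e) φ = homCoeff I m n φ := by
  have hme : monomial (m + e) (1 : ℂ) ∈ I := monomial_one_mem_of_le (by simp) hm
  rw [homCoeff_apply _ hm, homCoeff_apply _ hme, map_monomial_add e hm hme,
    quotCoeff_smul_add hI hn]

theorem homCoeff_add_of_not_le {m n e : σ →₀ ℕ} (hm : monomial m (1 : ℂ) ∈ I)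
    (hn : monomial n (1 : ℂ) ∉ I) (hne : ¬ e ≤ n)
    (φ : I →ₗ[MvPolynomial σ ℂ] (MvPolynomial σ ℂ ⧸ I)) :
    homCoeff I (m + e) n φ = 0 := by
  have hme : monomial (m + e) (1 : ℂ) ∈ I := monomial_one_mem_of_le (by simp) hm
  rw [homCoeff_apply _ hme, map_monomial_add e hm hme, quotCoeff_smul_of_not_le hI hn hne]

theorem homCoeff_ext {φ : I →ₗ[MvPolynomial σ ℂ] (MvPolynomial σ ℂ ⧸ I)}
    (h : ∀ m n, monomial m (1 : ℂ) ∈ I → monomial n (1 : ℂ) ∉ I → homCoeff I m n φ = 0) :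
    φ = 0 := by
  have hmon : ∀ m (hm : monomial m (1 : ℂ) ∈ I), φ ⟨_, hm⟩ = 0 := fun m hm =>
    quotCoeff_ext hI fun n hn => by rw [← homCoeff_apply n hm, h m n hm hn]
  ext1 ⟨f, hf⟩
  have hs : (⟨f, hf⟩ : I) = ∑ m ∈ f.support.attach,
      (C (coeff m.1 f) : MvPolynomial σ ℂ) • (⟨monomial m.1 1, hI f hf m.1 m.2⟩ : I) := by
    ext1
    change f = _
    conv_lhs => rw [f.as_sum, ← Finset.sum_attach]
    simp [C_mul_monomial]
  rw [hs, map_sum]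
  refine Finset.sum_eq_zero fun m _ => ?_
  rw [map_smul, hmon, smul_zero]

theorem exists_hom_of_monomial {M : Type*} [AddCommGroup M] [Module (MvPolynomial σ ℂ) M]
    (g : (σ →₀ ℕ) → M)
    (hg : ∀ m e, monomial m (1 : ℂ) ∈ I → g (m + e) = monomial e (1 : ℂ) • g m) :
    ∃ φ : I →ₗ[MvPolynomial σ ℂ] M, ∀ m (hm : monomial m (1 : ℂ) ∈ I), φ ⟨_, hm⟩ = g m := by
  let G : MvPolynomial σ ℂ → M := fun f =>
    (AddMonoidAlgebra.coeff f).sum fun m c => (C c : MvPolynomial σ ℂ) • g m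
  have hadd : ∀ p q, G (p + q) = G p + G q := fun p q => by
    simp only [G, AddMonoidAlgebra.coeff_add]
    exact Finsupp.sum_add_index' (by simp) (by simp [add_smul])
  have hmon : ∀ m c, G (monomial m c) = (C c : MvPolynomial σ ℂ) • g m := fun m c =>
    sum_monomial_eq (by simp)
  have hsum : ∀ {ι : Type _} (s : Finset ι) (p : ι → MvPolynomial σ ℂ),
      G (∑ i ∈ s, p i) = ∑ i ∈ s, G (p i) := fun s p =>
    map_sum (AddMonoidHom.mk' G hadd) p s
  have hsmul : ∀ (r f : MvPolynomial σ ℂ), f ∈ I → G (r * f) = r • G f := by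
    intro r f hf
    induction r using MvPolynomial.induction_on' with
    | add p q hp hq => rw [add_mul, hadd (p * f) (q * f), hp, hq, add_smul]
    | monomial e c =>
      conv_lhs => rw [f.as_sum, Finset.mul_sum, hsum]
      conv_rhs => rw [f.as_sum, hsum, Finset.smul_sum]
      refine Finset.sum_congr rfl fun m hm => ?_
      rw [monomial_mul, hmon, hmon, add_comm e m, hg m e (hI f hf m hm), smul_smul, smul_smul,
        C_mul_monomial, mul_comm (monomial e c), C_mul_monomial]
      simp [mul_comm]
  refine ⟨{ toFun := fun f => G f.1, map_add' := fun p q => hadd _ _,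
            map_smul' := fun r f => hsmul r f.1 f.2 }, fun m hm => ?_⟩
  simp [hmon]

theorem exists_hom_of_shift (P : (σ →₀ ℕ) → Prop) (s : (σ →₀ ℕ) → σ →₀ ℕ)
    (h₁ : ∀ m e, monomial m (1 : ℂ) ∈ I → P m → P (m + e) → s (m + e) = s m + e)
    (h₂ : ∀ m e, monomial m (1 : ℂ) ∈ I → P m → ¬ P (m + e) → monomial (s m + e) (1 : ℂ) ∈ I)
    (h₃ : ∀ m e, monomial m (1 : ℂ) ∈ I → ¬ P m → P (m + e) →
      monomial (s (m + e)) (1 : ℂ) ∈ I) :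
    ∃ φ : I →ₗ[MvPolynomial σ ℂ] (MvPolynomial σ ℂ ⧸ I),
      ∀ m n, monomial m (1 : ℂ) ∈ I → monomial n (1 : ℂ) ∉ I →
        (¬ (P m ∧ s m = n) → homCoeff I m n φ = 0) ∧
        (P m → s m = n → homCoeff I m n φ = 1) := by
  classical
  obtain ⟨φ, hφ⟩ := exists_hom_of_monomial hI
    (fun m => if P m then Ideal.Quotient.mk I (monomial (s m) (1 : ℂ)) else 0) (by
      intro m e hm
      by_cases hP : P m <;> by_cases hPe : P (m + e)
      · simp only [hP, hPe, if_true, h₁ m e hm hP hPe]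
        rw [monomial_smul_mk]
      · simp only [hP, hPe, if_true, if_false]
        rw [monomial_smul_mk, Ideal.Quotient.eq_zero_iff_mem.2 (h₂ m e hm hP hPe)]
      · simp only [hP, hPe, if_true, if_false, smul_zero]
        exact Ideal.Quotient.eq_zero_iff_mem.2 (h₃ m e hm hP hPe)
      · simp [hP, hPe])
  refine ⟨φ, fun m n hm hn => ⟨fun h => ?_, fun hP hs => ?_⟩⟩
  · rw [homCoeff_apply _ hm, hφ]
    split_ifs with hP
    · rw [quotCoeff_mk hI hn, coeff_monomial, if_neg fun hs => h ⟨hP, hs⟩]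
    · simp
  · rw [homCoeff_apply _ hm, hφ, if_pos hP, quotCoeff_mk hI hn, coeff_monomial, if_pos hs]

end Algebra

theorem linearIndependent_of_triangular {ι K V α : Type*} [Field K] [AddCommGroup V] [Module K V]
    [LinearOrder α] (v : ι → V) (f : ι → V →ₗ[K] K) (r : ι → α)
    (hdiag : ∀ p, f p (v p) ≠ 0) (htri : ∀ p q, q ≠ p → r q ≤ r p → f p (v q) = 0) :
    LinearIndependent K v := by
  classical
  rw [linearIndependent_iff']
  intro s g hg
  by_contra! hne
  obtain ⟨p₀, hp₀, hp₀'⟩ := hne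
  obtain ⟨p, hp, hmax⟩ := (s.filter fun p => g p ≠ 0).exists_max_image r
    ⟨p₀, by simp [hp₀, hp₀']⟩
  rw [Finset.mem_filter] at hp
  have := congrArg (f p) hg
  rw [map_sum, map_zero, Finset.sum_eq_single p] at this
  · simp [hp.2, hdiag p] at this
  · intro q hq hqp
    by_cases hgq : g q = 0
    · simp [hgq]
    · simp [htri p q hqp (hmax q (by simp [hq, hgq]))]
  · exact fun h => absurd hp.1 h

section ThreeVariables

/-- The exponent vector of `x ^ i * y ^ j * z ^ k`. -/
noncomputable def expo (i j k : ℕ) : Fin 3 →₀ ℕ := Finsupp.equivFunOnFinite.symm ![i, j, k]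

@[simp] theorem expo_zero (i j k : ℕ) : expo i j k 0 = i := rfl

@[simp] theorem expo_one (i j k : ℕ) : expo i j k 1 = j := rfl

@[simp] theorem expo_two (i j k : ℕ) : expo i j k 2 = k := rfl

theorem exponent_ext {m n : Fin 3 →₀ ℕ} (h0 : m 0 = n 0) (h1 : m 1 = n 1) (h2 : m 2 = n 2) :
    m = n := by
  ext t
  fin_cases t <;> assumption

theorem expo_self (m : Fin 3 →₀ ℕ) : expo (m 0) (m 1) (m 2) = m := exponent_ext rfl rfl rfl

theorem expo_add (i j k p q r : ℕ) :
    expo (i + p) (j + q) (k + r) = expo i j k + expo p q r := exponent_ext rfl rfl rfl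

theorem exponent_le_iff {m n : Fin 3 →₀ ℕ} : m ≤ n ↔ m 0 ≤ n 0 ∧ m 1 ≤ n 1 ∧ m 2 ≤ n 2 := by
  rw [Finsupp.le_def]
  exact ⟨fun h => ⟨h 0, h 1, h 2⟩, fun h t => by fin_cases t <;> simp [h]⟩

/-- `I` is a monomial ideal whose standard monomials in `z`-degree `k` are the
`x ^ i * y ^ j * z ^ k` with `i < a k` and `j < b k`. -/
structure HasRectangularLayers (I : Ideal (MvPolynomial (Fin 3) ℂ)) (a b : ℕ → ℕ) : Prop where
  isMonomialIdeal : IsMonomialIdeal I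
  mem_iff : ∀ m, monomial m (1 : ℂ) ∈ I ↔ a (m 2) ≤ m 0 ∨ b (m 2) ≤ m 1
  antitone_left : Antitone a
  antitone_right : Antitone b
  eventually_zero : ∃ h, ∀ l, h ≤ l → a l = 0

theorem exists_hasRectangularLayers {I : Ideal (MvPolynomial (Fin 3) ℂ)}
    (hgen : ∃ S : Set (Fin 3 →₀ ℕ), (∀ s ∈ S, s 0 = 0 ∨ s 1 = 0) ∧
      I = Ideal.span ((fun s => (monomial s (1 : ℂ) : MvPolynomial (Fin 3) ℂ)) '' S))
    (hfin : FiniteDimensional ℂ (MvPolynomial (Fin 3) ℂ ⧸ I)) :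
    ∃ a b, HasRectangularLayers I a b := by
  classical
  obtain ⟨S, hS, rfl⟩ := hgen
  set I := Ideal.span ((fun s => (monomial s (1 : ℂ) : MvPolynomial (Fin 3) ℂ)) '' S)
  have hI : IsMonomialIdeal I := isMonomialIdeal_span S
  have hmem : ∀ m, monomial m (1 : ℂ) ∈ I ↔ ∃ s ∈ S, s ≤ m := fun m => by
    rw [mem_ideal_span_monomial_image, support_monomial, if_neg one_ne_zero]
    simp
  have : Finite {n : Fin 3 →₀ ℕ // monomial n (1 : ℂ) ∉ I} :=
    Module.Finite.finite_basis (standardMonomialBasis hI)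
  have hpure : ∀ e : ℕ → Fin 3 →₀ ℕ, Function.Injective e →
      ∃ i, monomial (e i) (1 : ℂ) ∈ I := by
    intro e he
    by_contra! hc
    exact not_injective_infinite_finite
      (fun i => (⟨e i, hc i⟩ : {n : Fin 3 →₀ ℕ // monomial n (1 : ℂ) ∉ I}))
      fun i j hij => he (congrArg Subtype.val hij)
  have hx : ∀ k, ∃ i, monomial (expo i 0 k) (1 : ℂ) ∈ I := fun k =>
    hpure (fun i => expo i 0 k) fun i j hij => by simpa using DFunLike.congr_fun hij 0
  have hy : ∀ k, ∃ j, monomial (expo 0 j k) (1 : ℂ) ∈ I := fun k =>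
    hpure (fun j => expo 0 j k) fun i j hij => by simpa using DFunLike.congr_fun hij 1
  obtain ⟨h, hh⟩ := hpure (fun k => expo 0 0 k) fun i j hij => by
    simpa using DFunLike.congr_fun hij 2
  refine ⟨fun k => Nat.find (hx k), fun k => Nat.find (hy k), hI, fun m => ⟨fun hm => ?_, ?_⟩,
    fun k l hkl => ?_, fun k l hkl => ?_, h, fun l hl => ?_⟩
  · obtain ⟨s, hs, hsm⟩ := (hmem m).1 hm
    rw [exponent_le_iff] at hsm
    rcases hS s hs with h0 | h0
    · exact Or.inr (Nat.find_min' _ ((hmem _).2 ⟨s, hs, exponent_le_iff.2 (by simp [hsm, h0])⟩))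
    · exact Or.inl (Nat.find_min' _ ((hmem _).2 ⟨s, hs, exponent_le_iff.2 (by simp [hsm, h0])⟩))
  · rintro (hm | hm)
    · refine monomial_one_mem_of_le (exponent_le_iff.2 ?_) (Nat.find_spec (hx (m 2)))
      exact ⟨hm, Nat.zero_le _, le_rfl⟩
    · refine monomial_one_mem_of_le (exponent_le_iff.2 ?_) (Nat.find_spec (hy (m 2)))
      exact ⟨Nat.zero_le _, hm, le_rfl⟩
  · exact Nat.find_min' _ (monomial_one_mem_of_le (exponent_le_iff.2 (by simpa using hkl))
      (Nat.find_spec (hx k)))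
  · exact Nat.find_min' _ (monomial_one_mem_of_le (exponent_le_iff.2 (by simpa using hkl))
      (Nat.find_spec (hy k)))
  · exact (Nat.find_eq_zero _).2
      (monomial_one_mem_of_le (exponent_le_iff.2 (by simpa using hl)) hh)

namespace HasRectangularLayers

variable {I : Ideal (MvPolynomial (Fin 3) ℂ)} {a b : ℕ → ℕ} (hI : HasRectangularLayers I a b)
include hI

theorem expo_mem_iff {i j k : ℕ} :
    monomial (expo i j k) (1 : ℂ) ∈ I ↔ a k ≤ i ∨ b k ≤ j := hI.mem_iff _

theorem notMem_iff {m : Fin 3 →₀ ℕ} :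
    monomial m (1 : ℂ) ∉ I ↔ m 0 < a (m 2) ∧ m 1 < b (m 2) := by
  rw [hI.mem_iff]; push Not; rfl

theorem hom_ext {φ : I →ₗ[MvPolynomial (Fin 3) ℂ] (MvPolynomial (Fin 3) ℂ ⧸ I)}
    (hU : ∀ i j k l, k ≤ l → i < a l → j < b l → (a (l + 1) ≤ i ∨ b (l + 1) ≤ j) →
      homCoeff I (expo (a k) 0 k) (expo i j l) φ = 0)
    (hV : ∀ i j k l, k ≤ l → i < a l → j < b l → (a (l + 1) ≤ i ∨ b (l + 1) ≤ j) →
      homCoeff I (expo 0 (b k) k) (expo i j l) φ = 0)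
    (hW₁ : ∀ i j k l, l ≤ k → i < a k → j < b k → a (k + 1) ≤ i →
      homCoeff I (expo (a (k + 1)) 0 (k + 1))
        (expo (a l - 1 - i + a (k + 1)) (b l - 1 - j) l) φ = 0)
    (hW₂ : ∀ i j k l, l ≤ k → i < a k → j < b k → i < a (k + 1) → b (k + 1) ≤ j →
      homCoeff I (expo 0 (b (k + 1)) (k + 1))
        (expo (a l - 1 - i) (b l - 1 - j + b (k + 1)) l) φ = 0) :
    φ = 0 := by
  obtain ⟨h, hh⟩ := hI.eventually_zero
  refine homCoeff_ext hI.isMonomialIdeal fun m n hm hn => ?_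
  have := eq_zero_of_rectangular_layers hI.antitone_left hI.antitone_right hh
    (fun i j k i' j' k' => homCoeff I (expo i j k) (expo i' j' k') φ)
    (fun i j k i' j' k' p q r hm hi hj => by
      simp only [expo_add]
      refine homCoeff_add_add hI.isMonomialIdeal (hI.expo_mem_iff.2 hm) ?_ φ
      rw [← expo_add, hI.expo_mem_iff]
      omega)
    (fun i j k i' j' k' p q r hm hi hj h => by
      simp only [expo_add]
      refine homCoeff_add_of_not_le hI.isMonomialIdeal (hI.expo_mem_iff.2 hm)
        (hI.notMem_iff.2 ⟨hi, hj⟩) ?_ φ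
      rw [exponent_le_iff]
      simp only [expo_zero, expo_one, expo_two]
      omega)
    hU hV hW₁ hW₂ (m 0) (m 1) (m 2) (n 0) (n 1) (n 2) ((hI.mem_iff m).1 hm)
    (hI.notMem_iff.1 hn).1 (hI.notMem_iff.1 hn).2
  simpa only [expo_self] using this

/-- The topmost layer containing the column through a standard monomial. -/
theorem exists_top : ∃ t : {m : Fin 3 →₀ ℕ // monomial m (1 : ℂ) ∉ I} → ℕ, ∀ p,
    p.1 2 ≤ t p ∧ p.1 0 < a (t p) ∧ p.1 1 < b (t p) ∧
      (a (t p + 1) ≤ p.1 0 ∨ b (t p + 1) ≤ p.1 1) := by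
  obtain ⟨h, hh⟩ := hI.eventually_zero
  suffices h : ∀ p : {m : Fin 3 →₀ ℕ // monomial m (1 : ℂ) ∉ I}, ∃ t, p.1 2 ≤ t ∧
      p.1 0 < a t ∧ p.1 1 < b t ∧ (a (t + 1) ≤ p.1 0 ∨ b (t + 1) ≤ p.1 1) from
    ⟨fun p => (h p).choose, fun p => (h p).choose_spec⟩
  intro p
  have hp := hI.notMem_iff.1 p.2
  have : ∀ s l, h ≤ l + s → p.1 2 ≤ l → p.1 0 < a l → p.1 1 < b l → ∃ t, p.1 2 ≤ t ∧
      p.1 0 < a t ∧ p.1 1 < b t ∧ (a (t + 1) ≤ p.1 0 ∨ b (t + 1) ≤ p.1 1) := by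
    intro s
    induction s with
    | zero => intro l hl _ h0; rw [hh l hl] at h0; omega
    | succ s ih =>
      intro l hl h2 h0 h1
      by_cases htop : a (l + 1) ≤ p.1 0 ∨ b (l + 1) ≤ p.1 1
      · exact ⟨l, h2, h0, h1, htop⟩
      · exact ih (l + 1) (by omega) (by omega) (by omega) (by omega)
  exact this h _ (by omega) le_rfl hp.1 hp.2

theorem top_unique {i j t t' : ℕ} (h0 : i < a t) (h1 : j < b t)
    (ht : a (t + 1) ≤ i ∨ b (t + 1) ≤ j) (h0' : i < a t') (h1' : j < b t')
    (ht' : a (t' + 1) ≤ i ∨ b (t' + 1) ≤ j) : t = t' := by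
  rcases lt_trichotomy t t' with h | h | h
  · have := hI.antitone_left (Nat.succ_le_of_lt h)
    have := hI.antitone_right (Nat.succ_le_of_lt h)
    simp only [Nat.succ_eq_add_one] at *
    omega
  · exact h
  · have := hI.antitone_left (Nat.succ_le_of_lt h)
    have := hI.antitone_right (Nat.succ_le_of_lt h)
    simp only [Nat.succ_eq_add_one] at *
    omega

/-- Multiplication by `x ^ (p 0) * y ^ (p 1) * z ^ t / (x ^ a κ * z ^ κ)`, where `κ = p 2`, on the
monomials `x ^ i * y ^ j * z ^ k` with `a k ≤ i`, `k ≤ κ`, and zero on the others. -/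
theorem exists_hom_left (p : Fin 3 →₀ ℕ) (t : ℕ) (hpt : p 2 ≤ t)
    (ht : a (t + 1) ≤ p 0 ∨ b (t + 1) ≤ p 1) :
    ∃ φ : I →ₗ[MvPolynomial (Fin 3) ℂ] (MvPolynomial (Fin 3) ℂ ⧸ I),
      ∀ m n, monomial m (1 : ℂ) ∈ I → monomial n (1 : ℂ) ∉ I →
        (¬ ((m 2 ≤ p 2 ∧ a (m 2) ≤ m 0) ∧
          expo (m 0 + p 0 - a (p 2)) (m 1 + p 1) (m 2 + t - p 2) = n) → homCoeff I m n φ = 0) ∧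
        (m 2 ≤ p 2 ∧ a (m 2) ≤ m 0 →
          expo (m 0 + p 0 - a (p 2)) (m 1 + p 1) (m 2 + t - p 2) = n →
            homCoeff I m n φ = 1) := by
  refine exists_hom_of_shift hI.isMonomialIdeal (fun m => m 2 ≤ p 2 ∧ a (m 2) ≤ m 0)
    (fun m => expo (m 0 + p 0 - a (p 2)) (m 1 + p 1) (m 2 + t - p 2)) ?_ ?_ ?_
  · intro m e hm hP hPe
    have := hI.antitone_left hP.1
    apply exponent_ext <;> simp <;> omega
  · intro m e hm hP hPe
    have h1 := hI.antitone_left hP.1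
    have h2 := hI.antitone_left (Nat.le_add_right (m 2) (e 2))
    rw [hI.mem_iff]
    simp only [Finsupp.add_apply, expo_zero, expo_one, expo_two] at *
    have h3 := hI.antitone_left (show t + 1 ≤ m 2 + t - p 2 + e 2 by omega)
    have h4 := hI.antitone_right (show t + 1 ≤ m 2 + t - p 2 + e 2 by omega)
    omega
  · intro m e hm hP hPe
    rw [hI.mem_iff] at hm ⊢
    simp only [Finsupp.add_apply, expo_zero, expo_one, expo_two] at *
    have h4 := hI.antitone_right (show m 2 ≤ m 2 + e 2 + t - p 2 by omega)
    omega

/-- The analogue of `exists_hom_left` with the roles of `x` and `y` exchanged. -/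
theorem exists_hom_right (p : Fin 3 →₀ ℕ) (t : ℕ) (hpt : p 2 ≤ t)
    (ht : a (t + 1) ≤ p 0 ∨ b (t + 1) ≤ p 1) :
    ∃ φ : I →ₗ[MvPolynomial (Fin 3) ℂ] (MvPolynomial (Fin 3) ℂ ⧸ I),
      ∀ m n, monomial m (1 : ℂ) ∈ I → monomial n (1 : ℂ) ∉ I →
        (¬ ((m 2 ≤ p 2 ∧ b (m 2) ≤ m 1) ∧
          expo (m 0 + p 0) (m 1 + p 1 - b (p 2)) (m 2 + t - p 2) = n) → homCoeff I m n φ = 0) ∧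
        (m 2 ≤ p 2 ∧ b (m 2) ≤ m 1 →
          expo (m 0 + p 0) (m 1 + p 1 - b (p 2)) (m 2 + t - p 2) = n →
            homCoeff I m n φ = 1) := by
  refine exists_hom_of_shift hI.isMonomialIdeal (fun m => m 2 ≤ p 2 ∧ b (m 2) ≤ m 1)
    (fun m => expo (m 0 + p 0) (m 1 + p 1 - b (p 2)) (m 2 + t - p 2)) ?_ ?_ ?_
  · intro m e hm hP hPe
    have := hI.antitone_right hP.1
    apply exponent_ext <;> simp <;> omega
  · intro m e hm hP hPe
    have h1 := hI.antitone_right hP.1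
    have h2 := hI.antitone_right (Nat.le_add_right (m 2) (e 2))
    rw [hI.mem_iff]
    simp only [Finsupp.add_apply, expo_zero, expo_one, expo_two] at *
    have h3 := hI.antitone_left (show t + 1 ≤ m 2 + t - p 2 + e 2 by omega)
    have h4 := hI.antitone_right (show t + 1 ≤ m 2 + t - p 2 + e 2 by omega)
    omega
  · intro m e hm hP hPe
    rw [hI.mem_iff] at hm ⊢
    simp only [Finsupp.add_apply, expo_zero, expo_one, expo_two] at *
    have h4 := hI.antitone_left (show m 2 ≤ m 2 + e 2 + t - p 2 by omega)
    omega

/-- Multiplication by `x ^ (a κ - 1 - i) * y ^ (b κ - 1 - j) * z ^ κ / z ^ (t + 1)`, where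
`p = (i, j, κ)`, on the monomials of `z`-degree greater than `t`, and zero on the others. -/
theorem exists_hom_down (p : Fin 3 →₀ ℕ) (t : ℕ) (hp : monomial p (1 : ℂ) ∉ I)
    (h0 : p 0 < a t) (h1 : p 1 < b t) :
    ∃ φ : I →ₗ[MvPolynomial (Fin 3) ℂ] (MvPolynomial (Fin 3) ℂ ⧸ I),
      ∀ m n, monomial m (1 : ℂ) ∈ I → monomial n (1 : ℂ) ∉ I →
        (¬ (t + 1 ≤ m 2 ∧ expo (m 0 + a (p 2) - 1 - p 0) (m 1 + b (p 2) - 1 - p 1)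
          (m 2 + p 2 - t - 1) = n) → homCoeff I m n φ = 0) ∧
        (t + 1 ≤ m 2 → expo (m 0 + a (p 2) - 1 - p 0) (m 1 + b (p 2) - 1 - p 1)
          (m 2 + p 2 - t - 1) = n → homCoeff I m n φ = 1) := by
  rw [hI.notMem_iff] at hp
  refine exists_hom_of_shift hI.isMonomialIdeal (fun m => t + 1 ≤ m 2)
    (fun m => expo (m 0 + a (p 2) - 1 - p 0) (m 1 + b (p 2) - 1 - p 1)
          (m 2 + p 2 - t - 1)) ?_ ?_ ?_
  · intro m e hm hP hPe
    apply exponent_ext <;> simp <;> omega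
  · intro m e hm hP hPe
    simp only [Finsupp.add_apply] at hPe
    omega
  · intro m e hm hP hPe
    rw [hI.mem_iff] at hm ⊢
    simp only [Finsupp.add_apply, expo_zero, expo_one, expo_two] at *
    have h2 := hI.antitone_left (show m 2 ≤ t by omega)
    have h3 := hI.antitone_right (show m 2 ≤ t by omega)
    have h4 := hI.antitone_left (show p 2 ≤ m 2 + e 2 + p 2 - t - 1 by omega)
    have h5 := hI.antitone_right (show p 2 ≤ m 2 + e 2 + p 2 - t - 1 by omega)
    omega

theorem finrank_hom [FiniteDimensional ℂ (MvPolynomial (Fin 3) ℂ ⧸ I)] :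
    Module.finrank ℂ (I →ₗ[MvPolynomial (Fin 3) ℂ] (MvPolynomial (Fin 3) ℂ ⧸ I)) =
      3 * Module.finrank ℂ (MvPolynomial (Fin 3) ℂ ⧸ I) := by
  classical
  let B := {m : Fin 3 →₀ ℕ // monomial m (1 : ℂ) ∉ I}
  have : Finite B := Module.Finite.finite_basis (standardMonomialBasis hI.isMonomialIdeal)
  have : Fintype B := Fintype.ofFinite B
  rw [Module.finrank_eq_card_basis (standardMonomialBasis hI.isMonomialIdeal)]
  obtain ⟨t, ht⟩ := hI.exists_top
  have hB : ∀ p : B, p.1 0 < a (p.1 2) ∧ p.1 1 < b (p.1 2) := fun p => hI.notMem_iff.1 p.2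
  have hBext : ∀ p q : B, p.1 0 = q.1 0 → p.1 1 = q.1 1 → p.1 2 = q.1 2 → p = q :=
    fun p q h0 h1 h2 => Subtype.ext (exponent_ext h0 h1 h2)
  choose u hu using fun p : B => hI.exists_hom_left p.1 (t p) (ht p).1 (ht p).2.2.2
  choose v hv using fun p : B => hI.exists_hom_right p.1 (t p) (ht p).1 (ht p).2.2.2
  choose w hw using fun p : B => hI.exists_hom_down p.1 (t p) p.2 (ht p).2.1 (ht p).2.2.1
  let f : B ⊕ B ⊕ B →
      (I →ₗ[MvPolynomial (Fin 3) ℂ] (MvPolynomial (Fin 3) ℂ ⧸ I)) →ₗ[ℂ] ℂ :=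
    Sum.elim (fun p => homCoeff I (expo (a (p.1 2)) 0 (p.1 2)) (expo (p.1 0) (p.1 1) (t p)))
      (Sum.elim (fun p => homCoeff I (expo 0 (b (p.1 2)) (p.1 2)) (expo (p.1 0) (p.1 1) (t p)))
        (fun p => if a (t p + 1) ≤ p.1 0 then
            homCoeff I (expo (a (t p + 1)) 0 (t p + 1))
              (expo (a (p.1 2) - 1 - p.1 0 + a (t p + 1)) (b (p.1 2) - 1 - p.1 1) (p.1 2))
          else homCoeff I (expo 0 (b (t p + 1)) (t p + 1))
              (expo (a (p.1 2) - 1 - p.1 0) (b (p.1 2) - 1 - p.1 1 + b (t p + 1)) (p.1 2))))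
  let r : B ⊕ B ⊕ B → ℤ :=
    Sum.elim (fun p => p.1 2) (Sum.elim (fun p => p.1 2) (fun p => - t p))
  have hx : ∀ k, monomial (expo (a k) 0 k) (1 : ℂ) ∈ I := fun k => hI.expo_mem_iff.2 (by simp)
  have hy : ∀ k, monomial (expo 0 (b k) k) (1 : ℂ) ∈ I := fun k => hI.expo_mem_iff.2 (by simp)
  have htop : ∀ p : B, monomial (expo (p.1 0) (p.1 1) (t p)) (1 : ℂ) ∉ I := fun p =>
    hI.notMem_iff.2 ⟨(ht p).2.1, (ht p).2.2.1⟩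
  have hleft : ∀ p : B, a (t p + 1) ≤ p.1 0 → monomial (expo
      (a (p.1 2) - 1 - p.1 0 + a (t p + 1)) (b (p.1 2) - 1 - p.1 1) (p.1 2)) (1 : ℂ) ∉ I := by
    intro p h
    have := hB p
    rw [hI.expo_mem_iff]
    omega
  have hright : ∀ p : B, ¬ a (t p + 1) ≤ p.1 0 → monomial (expo
      (a (p.1 2) - 1 - p.1 0) (b (p.1 2) - 1 - p.1 1 + b (t p + 1)) (p.1 2)) (1 : ℂ) ∉ I := by
    intro p h
    have := hB p
    have := ht p
    rw [hI.expo_mem_iff]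
    omega
  have hcoord : ∀ {i j k i' j' k' : ℕ}, expo i j k = expo i' j' k' →
      i = i' ∧ j = j' ∧ k = k' := fun h =>
    ⟨DFunLike.congr_fun h 0, DFunLike.congr_fun h 1, DFunLike.congr_fun h 2⟩
  have hli : LinearIndependent ℂ (Sum.elim u (Sum.elim v w)) := by
    refine linearIndependent_of_triangular _ f r ?_ ?_
    · rintro (p | p | p)
      · refine ne_of_eq_of_ne ((hu p _ _ (hx _) (htop p)).2 ?_ ?_) one_ne_zero
        · simp
        · apply exponent_ext <;> simp
      · refine ne_of_eq_of_ne ((hv p _ _ (hy _) (htop p)).2 ?_ ?_) one_ne_zero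
        · simp
        · apply exponent_ext <;> simp
      · have h1 := hB p
        have h2 := ht p
        simp only [f, Sum.elim_inr]
        split_ifs with h
        · refine ne_of_eq_of_ne ((hw p _ _ (hx _) (hleft p h)).2 ?_ ?_) one_ne_zero
          · simp
          · apply exponent_ext <;> simp <;> omega
        · refine ne_of_eq_of_ne ((hw p _ _ (hy _) (hright p h)).2 ?_ ?_) one_ne_zero
          · simp
          · apply exponent_ext <;> simp <;> omega
    · rintro (p | p | p) (q | q | q) hqp hr <;>
        simp only [f, r, Sum.elim_inl, Sum.elim_inr] at hr ⊢
      · refine (hu q _ _ (hx _) (htop p)).1 ?_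
        rintro ⟨h, h'⟩
        have h' := hcoord h'
        simp only [expo_zero, expo_one, expo_two] at h h'
        have hk : p.1 2 = q.1 2 := by omega
        rw [hk] at h'
        exact hqp (congrArg _ (hBext q p (by omega) (by omega) hk.symm))
      · refine (hv q _ _ (hx _) (htop p)).1 ?_
        rintro ⟨h, -⟩
        have := hB p
        simp only [expo_one, expo_two] at h
        omega
      · refine (hw q _ _ (hx _) (htop p)).1 ?_
        rintro ⟨h, h'⟩
        have h' := hcoord h'
        have := hB p
        have := ht p
        have := hB q
        have := ht q
        simp only [expo_zero, expo_one, expo_two] at h h'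
        omega
      · refine (hu q _ _ (hy _) (htop p)).1 ?_
        rintro ⟨h, -⟩
        have := hB p
        simp only [expo_zero, expo_two] at h
        omega
      · refine (hv q _ _ (hy _) (htop p)).1 ?_
        rintro ⟨h, h'⟩
        have h' := hcoord h'
        simp only [expo_zero, expo_one, expo_two] at h h'
        have hk : p.1 2 = q.1 2 := by omega
        rw [hk] at h'
        exact hqp (congrArg _ (congrArg _ (hBext q p (by omega) (by omega) hk.symm)))
      · refine (hw q _ _ (hy _) (htop p)).1 ?_
        rintro ⟨h, h'⟩
        have h' := hcoord h'
        have := hB p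
        have := ht p
        have := hB q
        have := ht q
        simp only [expo_zero, expo_one, expo_two] at h h'
        omega
      · have hp := ht p
        have hq := ht q
        split_ifs with hc
        · refine (hu q _ _ (hx _) (hleft p hc)).1 ?_
          rintro ⟨h, h'⟩
          have h' := hcoord h'
          simp only [expo_zero, expo_one, expo_two] at h h'
          omega
        · refine (hu q _ _ (hy _) (hright p hc)).1 ?_
          rintro ⟨h, h'⟩
          have h' := hcoord h'
          simp only [expo_zero, expo_one, expo_two] at h h'
          omega
      · have hp := ht p
        have hq := ht q
        split_ifs with hc
        · refine (hv q _ _ (hx _) (hleft p hc)).1 ?_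
          rintro ⟨h, h'⟩
          have h' := hcoord h'
          simp only [expo_zero, expo_one, expo_two] at h h'
          omega
        · refine (hv q _ _ (hy _) (hright p hc)).1 ?_
          rintro ⟨h, h'⟩
          have h' := hcoord h'
          simp only [expo_zero, expo_one, expo_two] at h h'
          omega
      · have hp := hB p
        have hq := hB q
        split_ifs with hc
        · refine (hw q _ _ (hx _) (hleft p hc)).1 ?_
          rintro ⟨h, h'⟩
          have h' := hcoord h'
          simp only [expo_zero, expo_one, expo_two] at h h'
          have hk : q.1 2 = p.1 2 := by omega
          rw [hk] at h' hq
          exact hqp (congrArg _ (congrArg _ (hBext q p (by omega) (by omega) hk)))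
        · refine (hw q _ _ (hy _) (hright p hc)).1 ?_
          rintro ⟨h, h'⟩
          have h' := hcoord h'
          simp only [expo_zero, expo_one, expo_two] at h h'
          have hk : q.1 2 = p.1 2 := by omega
          rw [hk] at h' hq
          exact hqp (congrArg _ (congrArg _ (hBext q p (by omega) (by omega) hk)))
  have hinj : Function.Injective (LinearMap.pi f) := by
    rw [← LinearMap.ker_eq_bot, LinearMap.ker_eq_bot']
    intro φ hφ
    have hf : ∀ p, f p φ = 0 := fun p => congrFun hφ p
    have hB' : ∀ {i j k l : ℕ}, k ≤ l → i < a l → j < b l →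
        monomial (expo i j k) (1 : ℂ) ∉ I := fun h hi hj =>
      hI.notMem_iff.2 ⟨hi.trans_le (hI.antitone_left h), hj.trans_le (hI.antitone_right h)⟩
    have htop' : ∀ {i j k l : ℕ} (h : k ≤ l) (hi : i < a l) (hj : j < b l),
        (a (l + 1) ≤ i ∨ b (l + 1) ≤ j) → t ⟨expo i j k, hB' h hi hj⟩ = l :=
      fun h hi hj hl => hI.top_unique (ht ⟨_, hB' h hi hj⟩).2.1 (ht ⟨_, hB' h hi hj⟩).2.2.1
        (ht ⟨_, hB' h hi hj⟩).2.2.2 hi hj hl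
    refine hI.hom_ext ?_ ?_ ?_ ?_
    · intro i j k l h hi hj hl
      simpa [f, htop' h hi hj hl] using hf (Sum.inl ⟨_, hB' h hi hj⟩)
    · intro i j k l h hi hj hl
      simpa [f, htop' h hi hj hl] using hf (Sum.inr (Sum.inl ⟨_, hB' h hi hj⟩))
    · intro i j k l h hi hj hl
      simpa [f, htop' h hi hj (Or.inl hl), hl] using
        hf (Sum.inr (Sum.inr ⟨_, hB' h hi hj⟩))
    · intro i j k l h hi hj hl hl'
      simpa [f, htop' h hi hj (Or.inr hl'), hl.not_ge] using
        hf (Sum.inr (Sum.inr ⟨_, hB' h hi hj⟩))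
  have : Module.Finite ℂ (I →ₗ[MvPolynomial (Fin 3) ℂ] (MvPolynomial (Fin 3) ℂ ⧸ I)) :=
    Module.Finite.of_injective _ hinj
  have hcard : Fintype.card (B ⊕ B ⊕ B) = 3 * Fintype.card B := by
    simp only [Fintype.card_sum]
    ring
  have hle := LinearMap.finrank_le_finrank_of_injective hinj
  rw [Module.finrank_fintype_fun_eq_card] at hle
  have hge := hli.fintype_card_le_finrank
  exact (hle.antisymm hge).trans hcard

end HasRectangularLayers

end ThreeVariables

/-- If `I ⊆ ℂ[x,y,z]` is generated by monomials each of the form `x^i z^j` or `y^i z^j`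
and `dim ℂ R/I = d`, then `dim ℂ Hom_R(I, R/I) = 3d`. -/
theorem hilb_three_dim_rectangular_layers_smooth (d : ℕ)
    (I : Ideal (MvPolynomial (Fin 3) ℂ))
    (hgen : ∃ S : Set (Fin 3 →₀ ℕ), (∀ s ∈ S, s 0 = 0 ∨ s 1 = 0) ∧
      I = Ideal.span ((fun s => (monomial s (1 : ℂ) : MvPolynomial (Fin 3) ℂ)) '' S))
    (hfin : FiniteDimensional ℂ (MvPolynomial (Fin 3) ℂ ⧸ I))
    (hd : Module.finrank ℂ (MvPolynomial (Fin 3) ℂ ⧸ I) = d) :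
    Module.finrank ℂ (↥I →ₗ[MvPolynomial (Fin 3) ℂ] (MvPolynomial (Fin 3) ℂ ⧸ I)) = 3 * d := by
  obtain ⟨a, b, hI⟩ := exists_hasRectangularLayers hgen hfin
  rw [hI.finrank_hom, hd]
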